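/- arXiv:2303.10281 — 2 statements merged into one kernel-verified Lean document; each statement's English description precedes it below -/
import Mathlib

section
/- Let n ≥ 5 be an integer with n ≡ 5 (mod 6). Then the set S = {λ : ℝ | ∃ p : ZMod n → ℂ, ∀ j, 1 ≤ ‖p j‖ ∧ ‖p j‖ ≤ λ ∧ 1 ≤ ‖p j - p (j-1)‖ ∧ ‖p j - p (j-1)‖ ≤ λ} has least element 2·sin((π/6)·((n+1)/n)). (Equivalently, φ_ℂ(W_n) = 1 + 2·sin((π/6)·((n+1)/n)) for n ≡ 5 mod 6.) -/
open Real

/-- In a triangle whose three sides have lengths in `[1, l]`, where `l = 2 sin (π / 6 + d / 2)` and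
`d` is small, the angles differ from `π / 3` by at most `d`. -/
lemma abs_angle_sub_pi_div_three_le {V : Type*} [NormedAddCommGroup V] [InnerProductSpace ℝ V]
    {x y : V} {l d : ℝ} (hd : 0 ≤ d) (hd' : d ≤ π / 15) (hl : l = 2 * sin (π / 6 + d / 2))
    (hx : 1 ≤ ‖x‖) (hx' : ‖x‖ ≤ l) (hy : 1 ≤ ‖y‖) (hy' : ‖y‖ ≤ l)
    (hxy : 1 ≤ ‖x - y‖) (hxy' : ‖x - y‖ ≤ l) :
    |InnerProductGeometry.angle x y - π / 3| ≤ d := by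
  have hpi := pi_pos
  have hl1 : 1 ≤ l := hx.trans hx'
  have hl2 : l ≤ 3 / 2 := by
    have h := sin_le (show 0 ≤ π / 6 + d / 2 by positivity)
    have := pi_lt_d2
    linarith
  have hcos :=
    InnerProductGeometry.norm_sub_sq_eq_norm_sq_add_norm_sq_sub_two_mul_norm_mul_norm_mul_cos_angle x y
  have h0 := InnerProductGeometry.angle_nonneg x y
  have h0' := InnerProductGeometry.angle_le_pi x y
  set t := InnerProductGeometry.angle x y
  generalize ‖x‖ = a at *
  generalize ‖y‖ = b at *
  generalize ‖x - y‖ = c at *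
  have hab : 0 < a * b := by positivity
  have hmax : cos (π / 3 + d) = 1 - l ^ 2 / 2 := by
    rw [show π / 3 + d = 2 * (π / 6 + d / 2) by ring, cos_two_mul, cos_sq', hl]
    ring
  have hmin : 1 - 1 / (2 * l ^ 2) ≤ cos (π / 3 - d) := by
    have hs : cos (π / 3 - d) = 1 - 2 * sin (π / 6 - d / 2) ^ 2 := by
      rw [show π / 3 - d = 2 * (π / 6 - d / 2) by ring, cos_two_mul, cos_sq']
      ring
    have hprod : l * (2 * sin (π / 6 - d / 2)) = 2 * cos d - 1 := by
      have h := cos_sub_cos (π / 3) d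
      rw [cos_pi_div_three] at h
      rw [hl, show π / 6 + d / 2 = (π / 3 + d) / 2 by ring,
        show π / 6 - d / 2 = (π / 3 - d) / 2 by ring]
      linarith
    have hcd : 0 ≤ cos d := cos_nonneg_of_mem_Icc ⟨by linarith, by linarith⟩
    have hcd' := cos_le_one d
    have hle : (l * (2 * sin (π / 6 - d / 2))) ^ 2 ≤ 1 := by
      rw [hprod, sq_le_one_iff_abs_le_one, abs_le]
      constructor <;> linarith
    have : 2 * sin (π / 6 - d / 2) ^ 2 ≤ 1 / (2 * l ^ 2) := by
      rw [le_div_iff₀ (by positivity)]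
      linarith
    linarith
  have hge : cos (π / 3 + d) ≤ cos t := by
    rw [hmax]
    refine le_of_mul_le_mul_left ?_ hab
    nlinarith [sq_nonneg (a - b), mul_nonneg (sq_nonneg l) (show 0 ≤ a * b - 1 by nlinarith),
      mul_self_le_mul_self (by linarith : (0 : ℝ) ≤ c) hxy']
  have key : ∀ u v : ℝ, 1 ≤ u → u ≤ v → v ≤ l → l ^ 2 * (u - v) ^ 2 + u * v ≤ l ^ 2 := by
    intro u v hu huv hv
    have h1 : 0 ≤ l ^ 2 * ((v - u) * (l - v)) :=
      mul_nonneg (sq_nonneg l) (mul_nonneg (by linarith) (by linarith))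
    have h2 : l * (l - u) ≤ 1 := by nlinarith
    have h3 : 0 ≤ (v - u) * l * (1 - l * (l - u)) :=
      mul_nonneg (mul_nonneg (by linarith) (by linarith)) (by linarith)
    have h4 : 0 ≤ (l - v) * (l + u) := mul_nonneg (by linarith) (by linarith)
    nlinarith
  have hkey : l ^ 2 * (a - b) ^ 2 + a * b ≤ l ^ 2 := by
    rcases le_total a b with h | h
    · exact key a b hx h hy'
    · have := key b a hy h hx'
      linarith [show l ^ 2 * (a - b) ^ 2 + a * b = l ^ 2 * (b - a) ^ 2 + b * a by ring]
  have hle : cos t ≤ cos (π / 3 - d) := by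
    refine le_trans ?_ hmin
    rw [le_sub_iff_add_le, ← le_sub_iff_add_le', div_le_iff₀ (by positivity)]
    refine le_of_mul_le_mul_left ?_ hab
    nlinarith [mul_le_mul_of_nonneg_left (show 1 ≤ c * c by nlinarith) (sq_nonneg l)]
  rw [abs_le]
  constructor
  · by_contra! h
    exact absurd hle (not_le.2 (cos_lt_cos_of_nonneg_of_le_pi h0 (by linarith) (by linarith)))
  · by_contra! h
    exact absurd hge (not_le.2 (cos_lt_cos_of_nonneg_of_le_pi (by linarith) h0' (by linarith)))

/-- The signed angles along a closed sequence of nonzero complex numbers add up to a multiple of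
`2 π`. -/
lemma exists_sum_arg_div_eq {n : ℕ} [NeZero n] (p : ZMod n → ℂ) (hp : ∀ j, p j ≠ 0) :
    ∃ m : ℤ, ∑ j, Complex.arg (p j / p (j - 1)) = 2 * π * m := by
  have h : ((∑ j, Complex.arg (p j / p (j - 1)) : ℝ) : Real.Angle) = ((0 : ℝ) : Real.Angle) := by
    have hs : ∑ j, (Complex.arg (p (j - 1)) : Real.Angle) = ∑ j, (Complex.arg (p j) : Real.Angle) :=
      Equiv.sum_comp (Equiv.subRight (1 : ZMod n)) fun j => (Complex.arg (p j) : Real.Angle)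
    rw [← Real.Angle.coe_coeHom, map_sum]
    simp only [Real.Angle.coe_coeHom, Complex.arg_div_coe_angle (hp _) (hp _),
      Finset.sum_sub_distrib, hs, sub_self, Real.Angle.coe_zero]
  obtain ⟨m, hm⟩ := Real.Angle.angle_eq_iff_two_pi_dvd_sub.1 h
  exact ⟨m, by simpa using hm⟩

/-- An odd number of reals that are within `d` of `π / 3` in absolute value can add up to a multiple
of `2 π` only if `d` is at least `π / 3` divided by their number. -/
lemma pi_div_three_le_card_mul_of_sum_eq {ι : Type*} [Fintype ι] (hodd : Odd (Fintype.card ι))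
    {θ : ι → ℝ} {d : ℝ} (hθ : ∀ j, |(|θ j|) - π / 3| ≤ d) {m : ℤ} (hm : ∑ j, θ j = 2 * π * m) :
    π / 3 ≤ Fintype.card ι * d := by
  by_contra! hlt
  let ε : ι → ℤ := fun j => if 0 ≤ θ j then 1 else -1
  have hε : ∀ j, |θ j - π / 3 * ε j| ≤ d := by
    intro j
    have h := hθ j
    by_cases hj : 0 ≤ θ j
    · simpa [ε, hj, abs_of_nonneg hj] using h
    · rw [abs_of_neg (not_le.1 hj), abs_sub_comm] at h
      have : θ j - π / 3 * ε j = π / 3 - -θ j := by simp [ε, hj]; ring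
      rwa [this]
  have hsum : |2 * π * m - π / 3 * (∑ j, ε j : ℤ)| ≤ Fintype.card ι * d := by
    rw [← hm, Int.cast_sum, Finset.mul_sum, ← Finset.sum_sub_distrib]
    refine (Finset.abs_sum_le_sum_abs _ _).trans ((Finset.sum_le_sum fun j _ => hε j).trans ?_)
    simp
  have hε_odd : Odd (∑ j, ε j) := by
    have h : ∀ j, (ε j : ZMod 2) = 1 := fun j => by
      by_cases hj : 0 ≤ θ j <;> simp [ε, hj]
    rw [← ZMod.intCast_eq_one_iff_odd, Int.cast_sum]
    simpa [h] using ZMod.natCast_eq_one_iff_odd.2 hodd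
  have hdist : (1 : ℝ) ≤ |((6 * m - ∑ j, ε j : ℤ) : ℝ)| := by
    have : 6 * m - ∑ j, ε j ≠ 0 := by
      obtain ⟨k, hk⟩ := hε_odd
      omega
    exact_mod_cast Int.one_le_abs this
  have hfac : 2 * π * m - π / 3 * (∑ j, ε j : ℤ) = π / 3 * ((6 * m - ∑ j, ε j : ℤ) : ℝ) := by
    push_cast
    ring
  rw [hfac, abs_mul, abs_of_pos (by positivity : (0 : ℝ) < π / 3)] at hsum
  nlinarith [pi_pos]

theorem wheel_mod_five_least (n : ℕ) (hn : 5 ≤ n) (hmod : n % 6 = 5) :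
    IsLeast {l : ℝ | ∃ p : ZMod n → ℂ, ∀ j : ZMod n,
        1 ≤ ‖p j‖ ∧ ‖p j‖ ≤ l ∧ 1 ≤ ‖p j - p (j - 1)‖ ∧ ‖p j - p (j - 1)‖ ≤ l}
      (2 * Real.sin (Real.pi / 6 * (((n : ℝ) + 1) / (n : ℝ)))) := by
  have hpi := pi_pos
  have : NeZero n := ⟨by omega⟩
  have hn0 : (5 : ℝ) ≤ n := by exact_mod_cast hn
  have hangle : π / 6 * (((n : ℝ) + 1) / n) = π / 6 + π / (3 * n) / 2 := by
    field_simp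
    ring
  have hsmall : π / (3 * n) ≤ π / 15 := by
    gcongr
    linarith
  have hpos : 0 < π / (3 * n) := by positivity
  rw [hangle]
  constructor
  · obtain ⟨k, hk⟩ : ∃ k, n + 1 = 6 * k := ⟨(n + 1) / 6, by omega⟩
    have hkR : (n : ℝ) + 1 = 6 * k := by exact_mod_cast hk
    have hsin : 1 / 2 ≤ sin (π / 6 + π / (3 * n) / 2) := by
      rw [← sin_pi_div_six]
      exact sin_le_sin_of_le_of_le_pi_div_two (by linarith) (by linarith) (by linarith)
    have hnorm : ∀ j : ZMod n, ‖ZMod.stdAddChar j ^ k‖ = 1 := fun j => by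
      rw [ZMod.stdAddChar_apply, norm_pow, Circle.norm_coe, one_pow]
    have hroot : (ZMod.stdAddChar (1 : ZMod n)) ^ k =
        Complex.exp (Complex.I * (2 * (π / 6 + π / (3 * n) / 2) : ℝ)) := by
      have h := ZMod.stdAddChar_coe (N := n) 1
      have hkn : 2 * (π / 6 + π / (3 * n) / 2) = k * (2 * π / n) := by
        field_simp
        linarith
      rw [Int.cast_one] at h
      rw [h, ← Complex.exp_nat_mul, hkn]
      congr 1
      push_cast
      ring
    have hstep : ∀ j : ZMod n, ‖ZMod.stdAddChar j ^ k - ZMod.stdAddChar (j - 1) ^ k‖ =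
        2 * sin (π / 6 + π / (3 * n) / 2) := by
      intro j
      have h : ZMod.stdAddChar j ^ k - ZMod.stdAddChar (j - 1) ^ k =
          ZMod.stdAddChar (j - 1) ^ k * ((ZMod.stdAddChar (1 : ZMod n)) ^ k - 1) := by
        rw [mul_sub, ← mul_pow, ← AddChar.map_add_eq_mul, sub_add_cancel, mul_one]
      rw [h, norm_mul, hnorm, hroot, one_mul, Complex.norm_exp_I_mul_ofReal_sub_one,
        mul_div_cancel_left₀ _ two_ne_zero, norm_of_nonneg (by linarith)]
    refine ⟨fun j => ZMod.stdAddChar j ^ k, fun j => ?_⟩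
    rw [hnorm, hstep]
    exact ⟨le_rfl, by linarith, by linarith, le_rfl⟩
  · rintro l ⟨p, hp⟩
    by_contra! hlt
    have hl1 : 1 ≤ l := (hp 0).1.trans (hp 0).2.1
    have hl2 : l / 2 ≤ 1 := by
      linarith [sin_le_one (π / 6 + π / (3 * n) / 2)]
    have harc : π / 6 ≤ arcsin (l / 2) := by
      rw [le_arcsin_iff_sin_le' ⟨by linarith, by linarith⟩, sin_pi_div_six]
      linarith
    have harc' : arcsin (l / 2) < π / 6 + π / (3 * n) / 2 := by
      rw [arcsin_lt_iff_lt_sin' ⟨by linarith, by linarith⟩]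
      linarith
    obtain ⟨m, hm⟩ := exists_sum_arg_div_eq p fun j =>
      norm_pos_iff.1 (one_pos.trans_le (hp j).1)
    have hbound := pi_div_three_le_card_mul_of_sum_eq (d := 2 * arcsin (l / 2) - π / 3)
      (by rw [ZMod.card, Nat.odd_iff]; omega) (fun j => ?_) hm
    · rw [ZMod.card] at hbound
      have : (n : ℝ) * (2 * arcsin (l / 2) - π / 3) < n * (π / (3 * n)) := by
        gcongr
        linarith
      have heq : (n : ℝ) * (π / (3 * n)) = π / 3 := by field_simp
      linarith
    · obtain ⟨h1, h2, h3, h4⟩ := hp j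
      obtain ⟨h5, h6, -⟩ := hp (j - 1)
      rw [← Complex.angle_eq_abs_arg (norm_pos_iff.1 (one_pos.trans_le h1))
        (norm_pos_iff.1 (one_pos.trans_le h5))]
      refine abs_angle_sub_pi_div_three_le (l := l) (by linarith) (by linarith) ?_ h1 h2 h5 h6 h3 h4
      rw [show π / 6 + (2 * arcsin (l / 2) - π / 3) / 2 = arcsin (l / 2) by ring,
        sin_arcsin (by linarith) hl2]
      ring
end

section
/- Let G be a finite simple graph on a finite vertex type V that is 3-regular, let r ≥ 2 be a real number, and suppose G admits a complex nowhere-zero r-flow. Suppose G contains a cycle of odd length and let g be the minimum length of an odd cycle of G (the odd-girth). Then r ≥ 1 + 2·sin((π/6)·(g/(g-1))) if g ≡ 1 or g ≡ 3 (mod 6), and r ≥ 1 + 2·sin((π/6)·((g+1)/g)) if g ≡ 5 (mod 6). -/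
open Real SimpleGraph

/-- A complex nowhere-zero `r`-flow on a finite simple graph `G`: an assignment of a complex
number to each dart, antisymmetric under dart reversal, conserving flow at every vertex, and
with all norms in `[1, r - 1]`. -/
def HasComplexNZFlow {V : Type*} [Fintype V] [DecidableEq V]
    (G : SimpleGraph V) [DecidableRel G.Adj] (r : ℝ) : Prop :=
  ∃ f : G.Dart → ℂ,
    (∀ d : G.Dart, f d.symm = -f d) ∧
    (∀ v : V, ∑ d ∈ Finset.univ.filter (fun d : G.Dart => d.fst = v), f d = 0) ∧
    (∀ d : G.Dart, 1 ≤ ‖f d‖ ∧ ‖f d‖ ≤ r - 1)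

/-- In a triangle with sides `2 cos (π/3 - p)` and `2 cos (π/3 - q)` whose third side is at least
`1`, the angle opposite the third side is at least `π/3 - p - q`. -/
lemma pi_div_three_sub_le_angle {p q α : ℝ} (hp : 0 ≤ p) (hq : 0 ≤ q) (hpq : p + q ≤ π / 2)
    (hα : 0 ≤ α)
    (h : 1 ≤ (2 * cos (π / 3 - p)) ^ 2 + (2 * cos (π / 3 - q)) ^ 2
      - 2 * (2 * cos (π / 3 - p)) * (2 * cos (π / 3 - q)) * cos α) :
    π / 3 - p - q ≤ α := by
  by_contra! hlt
  have hpi := pi_pos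
  have hcos : cos (π / 3 - p - q) < cos α :=
    cos_lt_cos_of_nonneg_of_le_pi hα (by linarith) hlt
  have hcA : 0 < cos (π / 3 - p) := cos_pos_of_mem_Ioo ⟨by linarith, by linarith⟩
  have hcB : 0 < cos (π / 3 - q) := cos_pos_of_mem_Ioo ⟨by linarith, by linarith⟩
  have hsp : 0 ≤ sin p := sin_nonneg_of_nonneg_of_le_pi hp (by linarith)
  have hsq : 0 ≤ sin q := sin_nonneg_of_nonneg_of_le_pi hq (by linarith)
  have hc : 0 ≤ cos (p + q) := cos_nonneg_of_mem_Icc ⟨by linarith, hpq⟩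
  have key : 8 * cos (π / 3 - p) * cos (π / 3 - q) * cos (π / 3 - p - q)
      - (4 * cos (π / 3 - p) ^ 2 + 4 * cos (π / 3 - q) ^ 2 - 1)
      = 8 * sin p * sin q * cos (p + q) := by
    rw [show π / 3 - p - q = π / 3 - (p + q) by ring]
    simp only [cos_sub, cos_add, sin_add, cos_pi_div_three, sin_pi_div_three]
    have h3 : √3 ^ 2 = 3 := Real.sq_sqrt (by norm_num)
    have e1 := sin_sq_add_cos_sq p
    have e2 := sin_sq_add_cos_sq q
    generalize √3 = s at *
    generalize cos p = cp at *
    generalize cos q = cq at *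
    generalize sin p = sp at *
    generalize sin q = sq at *
    grind
  have hAB := mul_lt_mul_of_pos_left hcos (mul_pos hcA hcB)
  have := mul_nonneg (mul_nonneg hsp hsq) hc
  nlinarith

/-- In a triangle with sides `2 cos (π/3 - p)` and `2 cos (π/3 - q)` whose third side is at most
`2 sin (θ/2)`, the angle opposite the third side is at most `θ - p - q`. -/
lemma angle_le_sub {p q α θ : ℝ} (hp : 0 ≤ p) (hq : 0 ≤ q) (hpθ : 2 * p ≤ θ - π / 3)
    (hqθ : 2 * q ≤ θ - π / 3) (hθ : θ ≤ π / 2) (hα : α ≤ π)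
    (h : (2 * cos (π / 3 - p)) ^ 2 + (2 * cos (π / 3 - q)) ^ 2
      - 2 * (2 * cos (π / 3 - p)) * (2 * cos (π / 3 - q)) * cos α ≤ (2 * sin (θ / 2)) ^ 2) :
    α ≤ θ - p - q := by
  by_contra! hlt
  have hpi := pi_pos
  have hcos : cos α < cos (θ - p - q) :=
    cos_lt_cos_of_nonneg_of_le_pi (by linarith) hα hlt
  have hcA : 0 < cos (π / 3 - p) := cos_pos_of_mem_Ioo ⟨by linarith, by linarith⟩
  have hcB : 0 < cos (π / 3 - q) := cos_pos_of_mem_Ioo ⟨by linarith, by linarith⟩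
  have hAB := mul_lt_mul_of_pos_left hcos (mul_pos hcA hcB)
  -- the case `p = q`
  have hiso : sin (θ / 2) ≤ 2 * cos (π / 3 - (p + q) / 2) * sin (θ / 2 - (p + q) / 2) := by
    have e1 : 2 * cos (π / 3 - (p + q) / 2) * sin (θ / 2 - (p + q) / 2)
        = sin (θ / 2 + π / 3 - (p + q)) + sin (θ / 2 - π / 3) := by
      rw [sin_add_sin]
      rw [show (θ / 2 + π / 3 - (p + q) + (θ / 2 - π / 3)) / 2 = θ / 2 - (p + q) / 2 by ring,
        show (θ / 2 + π / 3 - (p + q) - (θ / 2 - π / 3)) / 2 = π / 3 - (p + q) / 2 by ring]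
      ring
    have e2 : sin (θ / 2) = sin (θ / 2 + π / 3) + sin (θ / 2 - π / 3) := by
      rw [sin_add, sin_sub, cos_pi_div_three]; ring
    have e3 := sin_sub_sin (θ / 2 + π / 3 - (p + q)) (θ / 2 + π / 3)
    rw [show (θ / 2 + π / 3 - (p + q) - (θ / 2 + π / 3)) / 2 = -((p + q) / 2) by ring,
      show (θ / 2 + π / 3 - (p + q) + (θ / 2 + π / 3)) / 2
        = θ / 2 + π / 3 - (p + q) / 2 by ring, sin_neg] at e3
    have e4 : 0 ≤ sin ((p + q) / 2) :=
      sin_nonneg_of_nonneg_of_le_pi (by linarith) (by linarith)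
    have e5 : cos (θ / 2 + π / 3 - (p + q) / 2) ≤ 0 :=
      cos_nonpos_of_pi_div_two_le_of_le (by linarith) (by linarith)
    nlinarith
  have hs : 0 ≤ sin (θ / 2) := sin_nonneg_of_nonneg_of_le_pi (by linarith) (by linarith)
  have hiso2 := mul_self_le_mul_self hs hiso
  have hM : 2 * cos (π / 3 - (p + q) / 2) ^ 2 = 1 + cos (2 * π / 3 - (p + q)) := by
    rw [cos_sq, show 2 * (π / 3 - (p + q) / 2) = 2 * π / 3 - (p + q) by ring]; ring
  have hN : 2 * sin (θ / 2 - (p + q) / 2) ^ 2 = 1 - cos (θ - p - q) := by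
    rw [sin_sq, cos_sq, show 2 * (θ / 2 - (p + q) / 2) = θ - p - q by ring]; ring
  have hu : cos (2 * π / 3 - (p + q)) ≤ cos (θ - p - q) :=
    cos_le_cos_of_nonneg_of_le_pi (by linarith) (by linarith) (by linarith)
  have hc := cos_le_one (q - p)
  have f1 : cos (2 * π / 3 - (p + q)) + cos (q - p)
      = 2 * cos (π / 3 - p) * cos (π / 3 - q) := by
    rw [show 2 * π / 3 - (p + q) = (π / 3 - p) + (π / 3 - q) by ring,
      show q - p = (π / 3 - p) - (π / 3 - q) by ring, cos_add, cos_sub (π / 3 - p)]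
    ring
  have f2 : cos (2 * π / 3 - (p + q)) * cos (q - p)
      = cos (π / 3 - p) ^ 2 + cos (π / 3 - q) ^ 2 - 1 := by
    rw [show 2 * π / 3 - (p + q) = (π / 3 - p) + (π / 3 - q) by ring,
      show q - p = (π / 3 - p) - (π / 3 - q) by ring, cos_add, cos_sub (π / 3 - p)]
    have g1 := sin_sq_add_cos_sq (π / 3 - p)
    have g2 := sin_sq_add_cos_sq (π / 3 - q)
    grind
  have hprod := mul_nonneg (sub_nonneg.2 hc) (sub_nonneg.2 hu)
  have hMN : (1 + cos (2 * π / 3 - (p + q))) * (1 - cos (θ - p - q)) =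
      4 * cos (π / 3 - (p + q) / 2) ^ 2 * sin (θ / 2 - (p + q) / 2) ^ 2 := by
    rw [← hM, ← hN]; ring
  nlinarith

lemma sin_mul_sin_le {t : ℝ} (ht : 1 ≤ t) (ht' : t ≤ 3 / 2) :
    4 * (sin (π / 6 * t) * sin (π / 6 / t)) ≤ 1 := by
  have ht0 : 0 < t := by linarith
  have hpi := pi_gt_d2
  have hpi' := pi_lt_d2
  set s := t⁻¹ with hs
  have hts : t * s = 1 := mul_inv_cancel₀ ht0.ne'
  have hs0 : 0 < s := inv_pos.2 ht0
  have hst : s ≤ t := by nlinarith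
  set P := π / 6 * (t - s) with hP
  set Q := π / 6 * (t + s) with hQ
  have hprod : 2 * (sin (π / 6 * t) * sin (π / 6 / t)) = cos P - cos Q := by
    rw [hP, hQ, div_eq_mul_inv (π / 6) t, ← hs, mul_sub, mul_add, cos_sub, cos_add]; ring
  have hQP : (Q - π / 3) * (Q + π / 3) = P ^ 2 := by
    rw [hP, hQ]; linear_combination (π ^ 2 / 9) * hts
  have hQ3 : π / 3 ≤ Q := by
    rw [hQ]; nlinarith [sq_nonneg (t - s), mul_pos ht0 hs0]
  have hP0 : 0 ≤ P := mul_nonneg (by positivity) (by linarith)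
  have hP1 : P ≤ 1 / 2 := by
    have : t - s ≤ 5 / 6 := by nlinarith
    rw [hP]; nlinarith
  have hsin := sin_ge_sub_cube (x := P / 2) (by linarith)
  have hcosP : cos P = 1 - 2 * sin (P / 2) ^ 2 := by
    have := cos_sq (P / 2)
    rw [show 2 * (P / 2) = P by ring] at this
    have := sin_sq_add_cos_sq (P / 2)
    linarith
  have hcosQ : 1 / 2 - (Q - π / 3) ≤ cos Q := by
    have := (abs_le.1 (abs_cos_sub_cos_le Q (π / 3))).1
    rw [abs_of_nonneg (by linarith), cos_pi_div_three] at this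
    linarith
  have hQd : (Q - π / 3) * 2 ≤ P ^ 2 * 0.96 := by
    nlinarith
  have hsin2 : P / 2 * (1 - 1 / 96) ≤ sin (P / 2) := by nlinarith
  have hsin3 : (P / 2 * (1 - 1 / 96)) ^ 2 ≤ sin (P / 2) ^ 2 :=
    pow_le_pow_left₀ (by nlinarith) hsin2 2
  nlinarith

lemma sq_add_sq_sub_one_le {R κ a b : ℝ} (ha : 1 ≤ a) (haR : a ≤ R) (hb : 1 ≤ b) (hbR : b ≤ R)
    (h1 : R ≤ 2 * κ) (h2 : 2 * R ^ 2 - 1 ≤ 2 * R ^ 2 * κ) :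
    a ^ 2 + b ^ 2 - 1 ≤ 2 * a * b * κ := by
  rcases eq_or_lt_of_le (ha.trans haR) with hR | hR
  · have : a = 1 := by linarith
    have : b = 1 := by linarith
    subst_vars
    nlinarith
  · have hE1 : ∀ x, 1 ≤ x → x ≤ R → x ^ 2 ≤ 2 * x * κ := fun x h _ => by nlinarith
    have hER : R ^ 2 + b ^ 2 - 1 ≤ 2 * R * b * κ := by
      have i1 := mul_nonneg (sub_nonneg.2 hb) (sub_nonneg.2 h2)
      have i2 := mul_nonneg (sub_nonneg.2 hbR) (sub_nonneg.2 (hE1 R hR.le le_rfl))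
      have i3 := mul_nonneg (mul_nonneg (sub_nonneg.2 hb) (sub_nonneg.2 hbR)) (sub_pos.2 hR).le
      refine le_of_mul_le_mul_left ?_ (sub_pos.2 hR)
      nlinarith
    have i1 := mul_nonneg (sub_nonneg.2 ha) (sub_nonneg.2 hER)
    have i2 := mul_nonneg (sub_nonneg.2 haR) (sub_nonneg.2 (hE1 b hb hbR))
    have i3 := mul_nonneg (mul_nonneg (sub_nonneg.2 ha) (sub_nonneg.2 haR)) (sub_pos.2 hR).le
    refine le_of_mul_le_mul_left ?_ (sub_pos.2 hR)
    nlinarith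

/-- In a triangle with two sides in `[1, 2 sin (θ/2)]` and third side at least `1`, the angle
opposite the third side is at least `(π/3)² / θ`. -/
lemma sq_pi_div_three_div_le_angle {θ a b α : ℝ} (hθ : π / 3 ≤ θ) (hθ' : θ ≤ π / 2)
    (ha : 1 ≤ a) (haR : a ≤ 2 * sin (θ / 2)) (hb : 1 ≤ b) (hbR : b ≤ 2 * sin (θ / 2))
    (hα : 0 ≤ α) (h : 1 ≤ a ^ 2 + b ^ 2 - 2 * a * b * cos α) :
    (π / 3) ^ 2 / θ ≤ α := by
  have hpi := pi_pos
  obtain ⟨t, rfl⟩ : ∃ t, θ = π / 3 * t := ⟨θ / (π / 3), by field_simp⟩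
  have ht : 1 ≤ t := by nlinarith
  have ht' : t ≤ 3 / 2 := by nlinarith
  have ht0 : 0 < t := by linarith
  rw [show (π / 3) ^ 2 / (π / 3 * t) = π / 3 / t by field_simp]
  by_contra! hlt
  have hle : π / 3 / t ≤ π / 3 := div_le_self (by positivity) ht
  have hcos : cos (π / 3 / t) < cos α :=
    cos_lt_cos_of_nonneg_of_le_pi hα (by linarith) hlt
  rw [show π / 3 * t / 2 = π / 6 * t by ring] at *
  have h1 : 2 * sin (π / 6 * t) ≤ 2 * cos (π / 3 / t) := by
    rw [← cos_pi_div_two_sub]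
    have : π / 3 / t ≤ π / 2 - π / 6 * t := by
      rw [div_le_iff₀ ht0]; nlinarith [mul_nonneg (sub_nonneg.2 ht) (sub_nonneg.2 ht')]
    have := cos_le_cos_of_nonneg_of_le_pi (by positivity) (by nlinarith) this
    linarith
  have hsn : 0 ≤ sin (π / 6 * t) :=
    sin_nonneg_of_nonneg_of_le_pi (by positivity) (by nlinarith)
  have hsn' : 0 ≤ sin (π / 6 / t) :=
    sin_nonneg_of_nonneg_of_le_pi (by positivity) (by
      have : π / 6 / t ≤ π / 6 := div_le_self (by positivity) ht
      linarith)
  have hs := sin_mul_sin_le ht ht'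
  have hs2 := pow_le_pow_left₀ (by positivity) hs 2
  have hcs : cos (π / 3 / t) = 1 - 2 * sin (π / 6 / t) ^ 2 := by
    have := cos_sq (π / 6 / t)
    rw [show 2 * (π / 6 / t) = π / 3 / t by ring] at this
    have := sin_sq_add_cos_sq (π / 6 / t)
    linarith
  have h2 : 2 * (2 * sin (π / 6 * t)) ^ 2 - 1
      ≤ 2 * (2 * sin (π / 6 * t)) ^ 2 * cos (π / 3 / t) := by
    rw [hcs]; nlinarith
  have := sq_add_sq_sub_one_le ha haR hb hbR h1 h2
  have := mul_lt_mul_of_pos_left hcos (show 0 < 2 * a * b by positivity)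
  linarith

lemma exists_sum_eq_two_pi_mul {x : ℕ → ℂ} (hx : ∀ i, x i ≠ 0) {g : ℕ} (hg : x g = x 0) :
    ∃ k : ℤ, ∑ i ∈ Finset.range g, (x (i + 1) / x i).arg = 2 * π * k := by
  have h : ((∑ i ∈ Finset.range g, (x (i + 1) / x i).arg : ℝ) : Real.Angle) = (0 : ℝ) := by
    have hsum := Finset.sum_range_sub (fun i => ((x i).arg : Real.Angle)) g
    rw [hg, sub_self] at hsum
    rw [← Real.Angle.coe_coeHom, map_sum, Real.Angle.coe_coeHom, Real.Angle.coe_zero, ← hsum]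
    exact Finset.sum_congr rfl fun i _ => Complex.arg_div_coe_angle (hx _) (hx _)
  simpa using Real.Angle.angle_eq_iff_two_pi_dvd_sub.1 h

lemma norm_sub_sq_eq_arg_div {z w : ℂ} (hz : z ≠ 0) (hw : w ≠ 0) :
    ‖w - z‖ ^ 2 = ‖z‖ ^ 2 + ‖w‖ ^ 2 - 2 * ‖z‖ * ‖w‖ * cos |(w / z).arg| := by
  have h : ‖z‖ * ‖w‖ * cos (w / z).arg = w.re * z.re + w.im * z.im := by
    have h1 := Complex.norm_mul_cos_arg (w / z)
    have hz' : ‖z‖ ≠ 0 := norm_ne_zero_iff.2 hz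
    have h2 : ‖z‖ * ‖w‖ * cos (w / z).arg = ‖z‖ ^ 2 * (‖w / z‖ * cos (w / z).arg) := by
      rw [norm_div]; field_simp
    rw [h2, h1, Complex.div_re, Complex.normSq_eq_norm_sq]
    field_simp
  rw [cos_abs]
  have e1 := Complex.sq_norm (w - z)
  have e2 := Complex.sq_norm z
  have e3 := Complex.sq_norm w
  simp only [Complex.normSq_apply, Complex.sub_re, Complex.sub_im] at e1 e2 e3
  linear_combination e1 - e2 - e3 + 2 * h

lemma four_le_sum_abs_sub {ε : ℕ → ℤ} (hε : ∀ i, ε i = 1 ∨ ε i = -1) {g : ℕ}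
    (hg : ε g = ε 0) (hne : ∃ i < g, ε (i + 1) ≠ ε i) :
    4 ≤ ∑ i ∈ Finset.range g, |ε (i + 1) - ε i| := by
  obtain ⟨j, hj, hne⟩ := hne
  have hj' := Finset.mem_range.2 hj
  have h0 := Finset.sum_range_sub ε g
  rw [hg, sub_self, ← Finset.add_sum_erase _ _ hj'] at h0
  rw [← Finset.add_sum_erase _ _ hj']
  have h1 := Finset.abs_sum_le_sum_abs (fun i => ε (i + 1) - ε i) ((Finset.range g).erase j)
  have h2 : 2 ≤ |ε (j + 1) - ε j| := by
    rcases hε j with a | a <;> rcases hε (j + 1) with b | b <;> simp_all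
  have h3 : ∑ i ∈ (Finset.range g).erase j, (ε (i + 1) - ε i) = -(ε (j + 1) - ε j) := by linarith
  rw [h3, abs_neg] at h1
  linarith

lemma sum_odd_of_odd {ε : ℕ → ℤ} (hε : ∀ i, ε i = 1 ∨ ε i = -1) {g : ℕ} (hg : Odd g) :
    Odd (∑ i ∈ Finset.range g, ε i) := by
  have h : ∀ n : ℕ, Even (∑ i ∈ Finset.range n, ε i - n) := fun n => by
    induction n with
    | zero => simp
    | succ n ih =>
      rw [Finset.sum_range_succ]
      obtain ⟨m, hm⟩ := ih
      rcases hε n with e | e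
      · exact ⟨m, by push_cast; omega⟩
      · exact ⟨m - 1, by push_cast; omega⟩
  obtain ⟨m, hm⟩ := h g
  obtain ⟨l, hl⟩ := hg
  exact ⟨m + l, by omega⟩

lemma abs_six_mul_eq_sub_one {g : ℕ} {k e : ℤ} (hg : g % 6 = 1) (he : e = 1 ∨ e = -1)
    (h : |6 * k - g * e| < 3) : |6 * k| = g - 1 := by
  rcases he with rfl | rfl <;> rw [abs_lt] at h <;>
    rcases abs_cases (6 * k) with ⟨h', _⟩ | ⟨h', _⟩ <;> omega

lemma three_le_abs_six_mul_sub {g : ℕ} {k e : ℤ} (hg : g % 6 = 3) (he : e = 1 ∨ e = -1) :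
    3 ≤ |6 * k - g * e| := by
  by_contra! h
  rcases he with rfl | rfl <;> rw [abs_lt] at h <;> omega

/-- The rotation angles `ψ` of a closed sequence of vectors turning by about `± π/3` at each step:
`ψ i` deviates from `± π/3` by a part bounded by `δ/2` and a part coming from the lengths `q`. -/
lemma abs_sum_sub_le {ε : ℕ → ℤ} {q ψ : ℕ → ℝ} {δ : ℝ} {g : ℕ}
    (hε : ∀ i, ε i = 1 ∨ ε i = -1) (hεg : ε g = ε 0) (hqg : q g = q 0)
    (hq : ∀ i, |q i| ≤ δ / 4)
    (hψ : ∀ i, |ψ i - ε i * (π / 3) - ε i * (q i + q (i + 1))| ≤ δ / 2) :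
    |∑ i ∈ Finset.range g, ψ i - (∑ i ∈ Finset.range g, ε i : ℤ) * (π / 3)|
      ≤ g * δ - δ / 4 * (∑ i ∈ Finset.range g, |ε (i + 1) - ε i| : ℤ) := by
  have h1 : ∑ i ∈ Finset.range g, (ε i : ℝ) * (q i + q (i + 1))
      = ∑ i ∈ Finset.range g, (ε i + ε (i + 1) : ℝ) * q (i + 1) := by
    have := Finset.sum_range_sub (fun i => (ε i : ℝ) * q i) g
    simp only [hεg, hqg, sub_self] at this
    rw [← sub_eq_zero, ← Finset.sum_sub_distrib, ← neg_eq_zero, ← Finset.sum_neg_distrib, ← this]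
    exact Finset.sum_congr rfl fun i _ => by ring
  have h2 : ∑ i ∈ Finset.range g, ψ i - (∑ i ∈ Finset.range g, ε i : ℤ) * (π / 3)
      = ∑ i ∈ Finset.range g, ((ψ i - ε i * (π / 3) - ε i * (q i + q (i + 1)))
        + (ε i + ε (i + 1) : ℝ) * q (i + 1)) := by
    rw [Finset.sum_add_distrib, ← h1, ← Finset.sum_add_distrib]
    push_cast
    rw [Finset.sum_mul, ← Finset.sum_sub_distrib]
    exact Finset.sum_congr rfl fun i _ => by ring
  have h3 : (g : ℝ) * δ - δ / 4 * (∑ i ∈ Finset.range g, |ε (i + 1) - ε i| : ℤ)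
      = ∑ i ∈ Finset.range g, (δ - δ / 4 * |(ε (i + 1) : ℝ) - ε i|) := by
    rw [Finset.sum_sub_distrib, ← Finset.mul_sum]
    simp
  rw [h2, h3]
  refine (Finset.abs_sum_le_sum_abs _ _).trans (Finset.sum_le_sum fun i _ => ?_)
  have h4 : |(ε i : ℝ) + ε (i + 1)| = 2 - |(ε (i + 1) : ℝ) - ε i| := by
    rcases hε i with a | a <;> rcases hε (i + 1) with b | b <;> rw [a, b] <;> norm_num
  have h5 : |((ε i : ℝ) + ε (i + 1)) * q (i + 1)|
      ≤ (2 - |(ε (i + 1) : ℝ) - ε i|) * (δ / 4) := by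
    rw [abs_mul, h4]
    exact mul_le_mul_of_nonneg_left (hq _) (h4 ▸ abs_nonneg _)
  have := abs_add_le (ψ i - ε i * (π / 3) - ε i * (q i + q (i + 1)))
    ((ε i + ε (i + 1) : ℝ) * q (i + 1))
  linarith [hψ i]

/-- If the hub and the rim of a wheel with an odd number `g` of spokes are placed in the plane, with
all edges of length between `1` and `2 sin (θ/2)`, then `θ` is bounded below. -/
theorem wheel_angle_bound {g : ℕ} (hodd : Odd g) {θ : ℝ} (hθ : π / 3 ≤ θ) (hθ' : θ ≤ π / 2)
    {x : ℕ → ℂ} (hper : ∀ i, x (i + g) = x i)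
    (hx : ∀ i, 1 ≤ ‖x i‖ ∧ ‖x i‖ ≤ 2 * sin (θ / 2))
    (hd : ∀ i, 1 ≤ ‖x (i + 1) - x i‖ ∧ ‖x (i + 1) - x i‖ ≤ 2 * sin (θ / 2)) :
    (g % 6 = 1 ∨ g % 6 = 3 → π / 3 * g ≤ θ * (g - 1)) ∧
      (g % 6 = 5 → π / 3 * (g + 1) ≤ θ * g) := by
  have hpi := pi_pos
  have hx0 : ∀ i, x i ≠ 0 := fun i => norm_pos_iff.1 (by linarith [(hx i).1])
  set ψ : ℕ → ℝ := fun i => (x (i + 1) / x i).arg with hψdef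
  set ε : ℕ → ℤ := fun i => if 0 ≤ ψ i then 1 else -1 with hεdef
  set h : ℕ → ℝ := fun i => π / 3 - arccos (‖x i‖ / 2) with hhdef
  set δ := θ - π / 3 with hδ
  have hε : ∀ i, ε i = 1 ∨ ε i = -1 := fun i => by simp only [hεdef]; split_ifs <;> simp
  have hxg : x g = x 0 := by simpa using hper 0
  have hxg1 : x (g + 1) = x 1 := by simpa [add_comm] using hper 1
  have hεg : ε g = ε 0 := by simp only [hεdef, hψdef, hxg, hxg1, zero_add]
  have hhg : h g = h 0 := by simp only [hhdef, hxg]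
  have hsin1 := sin_le_one (θ / 2)
  have h0 : ∀ i, 0 ≤ h i := fun i => by
    have := arccos_le_arccos (show 1 / 2 ≤ ‖x i‖ / 2 by linarith [(hx i).1])
    rw [← cos_pi_div_three, arccos_cos (by linarith) (by linarith)] at this
    simp only [hhdef]; linarith
  have hδh : ∀ i, 2 * h i ≤ δ := fun i => by
    have := arccos_le_arccos (show ‖x i‖ / 2 ≤ sin (θ / 2) by linarith [(hx i).2])
    rw [← cos_pi_div_two_sub, arccos_cos (by linarith) (by linarith)] at this
    simp only [hhdef, hδ]; linarith
  have hxh : ∀ i, 2 * cos (π / 3 - h i) = ‖x i‖ := fun i => by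
    simp only [hhdef, sub_sub_cancel]
    rw [cos_arccos (by linarith [(hx i).1]) (by linarith [(hx i).2])]
    ring
  have hlaw : ∀ i, ‖x (i + 1) - x i‖ ^ 2
      = ‖x i‖ ^ 2 + ‖x (i + 1)‖ ^ 2 - 2 * ‖x i‖ * ‖x (i + 1)‖ * cos |ψ i| :=
    fun i => norm_sub_sq_eq_arg_div (hx0 i) (hx0 (i + 1))
  have hlow : ∀ i, π / 3 - h i - h (i + 1) ≤ |ψ i| := fun i => by
    refine pi_div_three_sub_le_angle (h0 _) (h0 _) (by linarith [hδh i, hδh (i + 1)])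
      (abs_nonneg _) ?_
    rw [hxh, hxh, ← hlaw]
    exact one_le_pow₀ (hd i).1
  have hup : ∀ i, |ψ i| ≤ θ - h i - h (i + 1) := fun i => by
    refine angle_le_sub (h0 _) (h0 _) (hδh _) (hδh _) hθ' (Complex.abs_arg_le_pi _) ?_
    rw [hxh, hxh, ← hlaw]
    exact pow_le_pow_left₀ (norm_nonneg _) (hd i).2 2
  have hlow' : ∀ i, (π / 3) ^ 2 / θ ≤ |ψ i| := fun i =>
    sq_pi_div_three_div_le_angle hθ hθ' (hx i).1 (hx i).2 (hx (i + 1)).1 (hx (i + 1)).2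
      (abs_nonneg _) (by rw [← hlaw]; exact one_le_pow₀ (hd i).1)
  have hψε : ∀ i, ψ i = ε i * |ψ i| := fun i => by
    simp only [hεdef]
    split_ifs with hs
    · rw [abs_of_nonneg hs]; simp
    · rw [abs_of_neg (not_le.1 hs)]; simp
  obtain ⟨k, hk⟩ := exists_sum_eq_two_pi_mul hx0 hxg
  have hmain := abs_sum_sub_le (q := fun i => δ / 4 - h i) (ψ := ψ) (δ := δ) hε hεg
    (by simp only [hhg])
    (fun i => abs_le.2 ⟨by linarith [hδh i], by linarith [h0 i]⟩)
    (fun i => by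
      have a1 := hlow i
      have a2 := hup i
      rw [hψε i]
      rcases hε i with e | e <;> rw [e] <;> push_cast <;> rw [abs_le] <;>
        constructor <;> linarith)
  rw [show ∑ i ∈ Finset.range g, ψ i = 2 * π * k from hk] at hmain
  set S := ∑ i ∈ Finset.range g, ε i with hS
  have hSodd : Odd S := sum_odd_of_odd hε hodd
  have hmain' : (|6 * k - S| : ℤ) * (π / 3)
      ≤ g * δ - δ / 4 * (∑ i ∈ Finset.range g, |ε (i + 1) - ε i| : ℤ) := by
    refine le_trans (le_of_eq ?_) hmain
    push_cast
    rw [← abs_of_pos (show 0 < π / 3 by positivity), ← abs_mul,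
      abs_of_pos (show 0 < π / 3 by positivity)]
    congr 1; ring
  have hδ0 : 0 ≤ δ := by linarith
  by_cases hne : ∃ i < g, ε (i + 1) ≠ ε i
  · have h4 : (4 : ℝ) ≤ (∑ i ∈ Finset.range g, |ε (i + 1) - ε i| : ℤ) := by
      exact_mod_cast four_le_sum_abs_sub hε hεg hne
    have h1 : (1 : ℝ) ≤ (|6 * k - S| : ℤ) := by
      have : 1 ≤ |6 * k - S| := Int.one_le_abs (by
        obtain ⟨m, hm⟩ := hSodd
        omega)
      exact_mod_cast this
    have h5 : π / 3 ≤ g * δ - δ := by nlinarith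
    constructor
    · intro _; rw [hδ] at h5; linarith
    · intro _; rw [hδ] at h5; linarith
  · push Not at hne
    have hconst : ∀ i ≤ g, ε i = ε 0 := by
      intro i
      induction i with
      | zero => simp
      | succ i ih => intro hi; rw [hne i hi, ih (by omega)]
    have hSg : S = g * ε 0 := by
      rw [hS, Finset.sum_congr rfl fun i hi => hconst i (Finset.mem_range.1 hi).le]
      simp
    have hz : (∑ i ∈ Finset.range g, |ε (i + 1) - ε i| : ℤ) = 0 :=
      Finset.sum_eq_zero fun i hi => by rw [hne i (Finset.mem_range.1 hi)]; simp
    rw [hz, Int.cast_zero, mul_zero, sub_zero] at hmain'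
    have hge : ∀ n : ℤ, n ≤ |6 * k - S| → n * (π / 3) ≤ g * δ := fun n hn =>
      le_trans (mul_le_mul_of_nonneg_right (by exact_mod_cast hn) (by positivity)) hmain'
    have hg0 : (1 : ℝ) ≤ g := by exact_mod_cast hodd.pos
    have hfar : 3 ≤ |6 * k - S| → π / 3 * g ≤ θ * (g - 1) := fun h3 => by
      have h5 := hge 3 h3
      push_cast at h5
      have : δ ≤ π / 6 := by linarith
      rw [show θ = δ + π / 3 by rw [hδ]; ring]
      linarith
    constructor
    · rintro (h6 | h6)
      · by_cases h3 : 3 ≤ |6 * k - S|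
        · exact hfar h3
        · have hwind : |6 * k| = g - 1 := by
            rw [hSg, not_le] at h3
            exact abs_six_mul_eq_sub_one h6 (hε 0) h3
          have hsum : ∑ i ∈ Finset.range g, |ψ i| = (g - 1) * (π / 3) := by
            have e1 : ∑ i ∈ Finset.range g, |ψ i| = |∑ i ∈ Finset.range g, ψ i| := by
              have e2 : ∑ i ∈ Finset.range g, ψ i = ε 0 * ∑ i ∈ Finset.range g, |ψ i| := by
                rw [Finset.mul_sum]
                refine Finset.sum_congr rfl fun i hi => ?_
                rw [← hconst i (Finset.mem_range.1 hi).le]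
                exact hψε i
              rw [e2, abs_mul, abs_of_nonneg (Finset.sum_nonneg fun i _ => abs_nonneg (ψ i))]
              rcases hε 0 with e | e <;> rw [e] <;> simp
            have hw : |6 * (k : ℝ)| = g - 1 := by exact_mod_cast hwind
            rw [e1, show ∑ i ∈ Finset.range g, ψ i = 2 * π * k from hk, ← hw,
              show 2 * π * (k : ℝ) = 6 * k * (π / 3) by ring, abs_mul,
              abs_of_pos (show 0 < π / 3 by positivity)]
          have hle : g * ((π / 3) ^ 2 / θ) ≤ (g - 1) * (π / 3) := by
            rw [← hsum]
            simpa using Finset.card_nsmul_le_sum (Finset.range g) (fun i => |ψ i|) _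
              fun i _ => hlow' i
          have hθ0 : 0 < θ := by linarith
          rw [mul_div_assoc', div_le_iff₀ hθ0] at hle
          refine le_of_mul_le_mul_left ?_ (show 0 < π / 3 by positivity)
          linarith
      · refine hfar ?_
        rw [hSg]
        exact three_le_abs_six_mul_sub h6 (hε 0)
    · intro h6
      have h5 := hge 1 (Int.one_le_abs (by
        obtain ⟨m, hm⟩ := hSodd
        omega))
      rw [hδ] at h5
      push_cast at h5
      linarith

lemma norm_add_mem_of_flow {V : Type*} [Fintype V] [DecidableEq V] {G : SimpleGraph V}
    [DecidableRel G.Adj] (hcubic : ∀ v : V, G.degree v = 3) {R : ℝ} {f : G.Dart → ℂ}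
    (hcons : ∀ v : V, ∑ d ∈ Finset.univ.filter (fun d : G.Dart => d.fst = v), f d = 0)
    (hnorm : ∀ d : G.Dart, 1 ≤ ‖f d‖ ∧ ‖f d‖ ≤ R) {d₁ d₂ : G.Dart} (hne : d₁ ≠ d₂)
    (hfst : d₁.fst = d₂.fst) : 1 ≤ ‖f d₁ + f d₂‖ ∧ ‖f d₁ + f d₂‖ ≤ R := by
  set S := Finset.univ.filter (fun d : G.Dart => d.fst = d₂.fst) with hS
  have hcard : S.card = 3 := by rw [hS, G.dart_fst_fiber_card_eq_degree, hcubic]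
  have h1 : d₁ ∈ S := by simp [hS, hfst]
  have h2 : d₂ ∈ S.erase d₁ := Finset.mem_erase.2 ⟨hne.symm, by simp [hS]⟩
  obtain ⟨d₃, h3⟩ : ∃ d₃, (S.erase d₁).erase d₂ = {d₃} := Finset.card_eq_one.1 (by
    rw [Finset.card_erase_of_mem h2, Finset.card_erase_of_mem h1, hcard])
  have hsum := hcons d₂.fst
  rw [← hS, ← Finset.add_sum_erase _ _ h1, ← Finset.add_sum_erase _ _ h2, h3,
    Finset.sum_singleton, ← add_assoc] at hsum
  rw [eq_neg_of_add_eq_zero_left hsum, norm_neg]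
  exact hnorm d₃

/-- A cycle of length `g`, as a `g`-periodic non-backtracking sequence of darts. -/
lemma exists_periodic_darts {V : Type*} {G : SimpleGraph V} {v : V} {c : G.Walk v v}
    (hc : c.IsCycle) : ∃ D : ℕ → G.Dart, (∀ i, D (i + c.length) = D i) ∧
      ∀ i, (D i).symm.fst = (D (i + 1)).fst ∧ D (i + 1) ≠ (D i).symm := by
  have h3 := hc.three_le_length
  set g := c.length with hg
  have hlt : ∀ i, i % g < g := fun i => Nat.mod_lt _ (by omega)
  have hends : c.getVert g = c.getVert 0 := by rw [c.getVert_length, c.getVert_zero]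
  have hsucc : ∀ i, i % g + 1 < g ∧ (i + 1) % g = i % g + 1 ∨
      i % g + 1 = g ∧ (i + 1) % g = 0 := fun i => by
    rw [Nat.add_mod, Nat.mod_eq_of_lt (show 1 < g by omega)]
    rcases Nat.lt_or_ge (i % g + 1) g with h | h
    · exact .inl ⟨h, Nat.mod_eq_of_lt h⟩
    · have h' : i % g + 1 = g := by have := hlt i; omega
      exact .inr ⟨h', by rw [h', Nat.mod_self]⟩
  have hinj := hc.getVert_injOn
  refine ⟨fun i => ⟨(c.getVert (i % g), c.getVert (i % g + 1)), c.adj_getVert_succ (hlt i)⟩,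
    fun i => by simp, fun i => ⟨?_, fun h => ?_⟩⟩
  · change c.getVert (i % g + 1) = c.getVert ((i + 1) % g)
    rcases hsucc i with ⟨_, h⟩ | ⟨h', h⟩
    · rw [h]
    · rw [h, h', hends]
  · replace h : c.getVert ((i + 1) % g + 1) = c.getVert (i % g) :=
      congrArg (fun d : G.Dart => d.snd) h
    rcases Nat.eq_zero_or_pos (i % g) with h0 | h0
    · rw [h0, ← hends] at h
      have := hinj (by simp only [Set.mem_ofPred_eq]; have := hsucc i; omega)
        (by simp only [Set.mem_ofPred_eq]; omega) h
      have := hsucc i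
      omega
    · have := hinj (by simp only [Set.mem_ofPred_eq]; have := hsucc i; omega)
        (by simp only [Set.mem_ofPred_eq]; have := hsucc i; omega) h
      have := hsucc i
      omega

theorem odd_girth_lower_bound {V : Type*} [Fintype V] [DecidableEq V]
    (G : SimpleGraph V) [DecidableRel G.Adj]
    (hcubic : ∀ v : V, G.degree v = 3)
    (r : ℝ) (hr : 2 ≤ r) (hflow : HasComplexNZFlow G r)
    (g : ℕ)
    (hodd : ∃ (v : V) (c : G.Walk v v), c.IsCycle ∧ Odd c.length ∧ c.length = g)
    (hmin : ∀ (v : V) (c : G.Walk v v), c.IsCycle → Odd c.length → g ≤ c.length) :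
    (g % 6 = 1 ∨ g % 6 = 3 →
      1 + 2 * Real.sin (Real.pi / 6 * ((g : ℝ) / ((g : ℝ) - 1))) ≤ r) ∧
    (g % 6 = 5 →
      1 + 2 * Real.sin (Real.pi / 6 * (((g : ℝ) + 1) / (g : ℝ))) ≤ r) := by
  obtain ⟨f, hsymm, hcons, hnorm⟩ := hflow
  obtain ⟨v, c, hc, hgodd, rfl⟩ := hodd
  obtain ⟨D, hper, hD⟩ := exists_periodic_darts hc
  have h3 : (3 : ℝ) ≤ c.length := by exact_mod_cast hc.three_le_length
  set g := c.length
  have hpi := pi_pos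
  have key : ∀ t : ℝ, 1 ≤ t → t ≤ 3 / 2 →
      (∀ θ, π / 3 ≤ θ → θ ≤ π / 2 → r - 1 = 2 * sin (θ / 2) → π / 3 * t ≤ θ) →
      1 + 2 * sin (π / 6 * t) ≤ r := by
    intro t ht ht' H
    by_contra! hlt
    have hs := sin_le_one (π / 6 * t)
    have hmem : π / 6 * t ∈ Set.Icc (-(π / 2)) (π / 2) := ⟨by nlinarith, by nlinarith⟩
    have h1 : arcsin ((r - 1) / 2) < π / 6 * t :=
      (arcsin_lt_iff_lt_sin ⟨by linarith, by linarith⟩ hmem).2 (by linarith)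
    have h2 : π / 6 ≤ arcsin ((r - 1) / 2) :=
      (le_arcsin_iff_sin_le ⟨by linarith, by linarith⟩ ⟨by linarith, by linarith⟩).2
        (by rw [sin_pi_div_six]; linarith)
    have := H (2 * arcsin ((r - 1) / 2)) (by linarith) (by nlinarith) (by
      rw [mul_div_cancel_left₀ _ two_ne_zero, sin_arcsin (by linarith) (by linarith)]; ring)
    linarith
  have hwheel : ∀ θ, π / 3 ≤ θ → θ ≤ π / 2 → r - 1 = 2 * sin (θ / 2) →
      (g % 6 = 1 ∨ g % 6 = 3 → π / 3 * g ≤ θ * (g - 1)) ∧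
        (g % 6 = 5 → π / 3 * (g + 1) ≤ θ * g) := by
    intro θ h1 h2 hθ
    rw [hθ] at hnorm
    refine wheel_angle_bound hgodd h1 h2 (x := fun i => f (D i)) (fun i => by rw [hper])
      (fun i => hnorm _) fun i => ?_
    rw [sub_eq_add_neg, ← hsymm]
    exact norm_add_mem_of_flow hcubic hcons hnorm (hD i).2 (hD i).1.symm
  constructor
  · intro hg
    refine key _ ((one_le_div (by linarith)).2 (by linarith))
      ((div_le_iff₀ (by linarith)).2 (by linarith)) fun θ h1 h2 hθ => ?_
    rw [← mul_div_assoc, div_le_iff₀ (by linarith)]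
    exact (hwheel θ h1 h2 hθ).1 hg
  · intro hg
    refine key _ ((one_le_div (by linarith)).2 (by linarith))
      ((div_le_iff₀ (by linarith)).2 (by linarith)) fun θ h1 h2 hθ => ?_
    rw [← mul_div_assoc, div_le_iff₀ (by linarith)]
    exact (hwheel θ h1 h2 hθ).2 hg
end
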